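/- arXiv:2412.11843 — 2 statements merged into one kernel-verified Lean document; each statement's English description precedes it below -/
import Mathlib

section
/- Let G be a finite connected simple graph containing exactly one cycle, and suppose that this cycle has length 6 and contains two vertices at distance 3 from each other along the cycle (opposite vertices) each of whose degree in G is 2. Then the edge ideal I(G) is bridge-friendly. -/
/-- The "lcm" of a collection of supports of squarefree monomials: the union. -/
def lcmU {α : Type*} [DecidableEq α] (σ : Finset (Finset α)) : Finset α := σ.sup id

/-- `m` is a bridge of `σ`: `m ∈ σ` and removing `m` does not change the lcm. -/
def IsBridge {α : Type*} [DecidableEq α] (σ : Finset (Finset α)) (m : Finset α) : Prop :=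
  m ∈ σ ∧ lcmU (σ.erase m) = lcmU σ

/-- `m` is a gap of `σ` (relative to the generating set `M`): `m ∈ M`, `m ∉ σ`,
and adding `m` does not change the lcm. -/
def IsGap {α : Type*} [DecidableEq α] (M : Set (Finset α)) (σ : Finset (Finset α))
    (m : Finset α) : Prop :=
  m ∈ M ∧ m ∉ σ ∧ lcmU (insert m σ) = lcmU σ

/-- `m` is a true gap of `σ` w.r.t. the total order encoded by `ord`
(`a` dominates `b` iff `ord b < ord a`). -/
def IsTrueGap {α : Type*} [DecidableEq α] (M : Set (Finset α)) (ord : Finset α → ℕ)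
    (σ : Finset (Finset α)) (m : Finset α) : Prop :=
  IsGap M σ m ∧ ∀ m', IsBridge (insert m σ) m' → ord m' < ord m → IsBridge σ m'

/-- `σ` is potentially-type-2: it has a bridge dominating no true gap of `σ`. -/
def PotType2 {α : Type*} [DecidableEq α] (M : Set (Finset α)) (ord : Finset α → ℕ)
    (σ : Finset (Finset α)) : Prop :=
  ∃ m, IsBridge σ m ∧ ∀ g, IsTrueGap M ord σ g → ¬ ord g < ord m

/-- `b` is the smallest bridge of `σ` w.r.t. the total order encoded by `ord`. -/
def IsSBridge {α : Type*} [DecidableEq α] (ord : Finset α → ℕ) (σ : Finset (Finset α))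
    (b : Finset α) : Prop :=
  IsBridge σ b ∧ ∀ b', IsBridge σ b' → ord b ≤ ord b'

/-- `σ` is type-2: it is potentially-type-2, and any other potentially-type-2 `σ'` with
`σ' \ {sbridge σ'} = σ \ {sbridge σ}` satisfies `sbridge σ' ≻ sbridge σ`. -/
def Type2 {α : Type*} [DecidableEq α] (M : Set (Finset α)) (ord : Finset α → ℕ)
    (σ : Finset (Finset α)) : Prop :=
  PotType2 M ord σ ∧ ∀ σ' : Finset (Finset α), ↑σ' ⊆ M → σ' ≠ σ → PotType2 M ord σ' →
    ∀ b b', IsSBridge ord σ b → IsSBridge ord σ' b' → σ'.erase b' = σ.erase b →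
      ord b < ord b'

/-- `M` (an antichain of supports of the minimal generators of a squarefree monomial
ideal) is bridge-friendly: there is a total order on `M` (encoded by an injection
`ord : Finset α → ℕ`, where `a ≻ b` iff `ord b < ord a`) for which every
potentially-type-2 subset of `M` is type-2. -/
def BridgeFriendly {α : Type*} [DecidableEq α] (M : Set (Finset α)) : Prop :=
  ∃ ord : Finset α → ℕ, Set.InjOn ord M ∧
    ∀ σ : Finset (Finset α), ↑σ ⊆ M → PotType2 M ord σ → Type2 M ord σ

/-- The set of edges of a simple graph `G`, each edge recorded as a 2-element
`Finset` of vertices; this is the set of supports of the minimal generators of the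
edge ideal `I(G)`. -/
def edgeSets {V : Type*} [DecidableEq V] (G : SimpleGraph V) : Set (Finset V) :=
  {s | ∃ u v, G.Adj u v ∧ s = {u, v}}

/-- `G` contains exactly one cycle: some closed walk of `G` is a cycle, and all
cycles of `G` have the same edge set. -/
def ExactlyOneCycle {V : Type*} [DecidableEq V] (G : SimpleGraph V) : Prop :=
  (∃ (u : V) (w : G.Walk u u), w.IsCycle) ∧
    ∀ (u v : V) (w : G.Walk u u) (w' : G.Walk v v), w.IsCycle → w'.IsCycle →
      w.edges.toFinset = w'.edges.toFinset

section Bridges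

variable {α : Type*} [DecidableEq α] {M : Set (Finset α)} {ord : Finset α → ℕ}
  {σ σ' : Finset (Finset α)} {m b b' f g h : Finset α}

theorem mem_lcmU {v : α} : v ∈ lcmU σ ↔ ∃ e ∈ σ, v ∈ e := by
  simp [lcmU, Finset.mem_sup]

theorem isBridge_iff_forall_exists :
    IsBridge σ m ↔ m ∈ σ ∧ ∀ v ∈ m, ∃ e ∈ σ, e ≠ m ∧ v ∈ e := by
  simp only [IsBridge, Finset.ext_iff, mem_lcmU, Finset.mem_erase]
  refine and_congr_right fun hm ↦ ⟨fun h v hv ↦ ?_, fun h v ↦ ?_⟩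
  · obtain ⟨e, ⟨hne, he⟩, hve⟩ := (h v).2 ⟨m, hm, hv⟩
    exact ⟨e, he, hne, hve⟩
  · grind

theorem isGap_iff_forall_exists :
    IsGap M σ m ↔ m ∈ M ∧ m ∉ σ ∧ ∀ v ∈ m, ∃ e ∈ σ, v ∈ e := by
  rw [IsGap, Finset.ext_iff]
  simp only [mem_lcmU, Finset.exists_mem_insert]
  refine and_congr_right fun _ ↦ and_congr_right fun _ ↦ forall_congr' fun v ↦ ?_
  rw [or_iff_right_iff_imp]

theorem PotType2.not_lt_of_isTrueGap (hσ : PotType2 M ord σ) (hb : IsSBridge ord σ b)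
    (hg : IsTrueGap M ord σ g) : ¬ ord g < ord b := by
  obtain ⟨m, hm, hmg⟩ := hσ
  exact fun hlt ↦ hmg g hg (hlt.trans_le (hb.2 m hm))

/-- In a potentially-type-2 set, an edge dominated by the smallest bridge cannot have each of its
vertices covered by a member of the set that dominates it. -/
theorem PotType2.not_lt_of_covered (hσ : PotType2 M ord σ) (hb : IsSBridge ord σ b)
    (hf : f ∈ M) (hcov : ∀ v ∈ f, ∃ e ∈ σ, v ∈ e ∧ ord f < ord e) : ¬ ord f < ord b := by
  intro hfb
  by_cases hfσ : f ∈ σ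
  · have : IsBridge σ f := isBridge_iff_forall_exists.2 ⟨hfσ, by grind⟩
    exact (hb.2 f this).not_gt hfb
  · refine hσ.not_lt_of_isTrueGap hb ⟨isGap_iff_forall_exists.2 ⟨hf, hfσ, by grind⟩, ?_⟩ hfb
    intro m' hm' hlt
    rw [isBridge_iff_forall_exists] at hm' ⊢
    grind

/-- Two distinct potentially-type-2 sets with the same reduced set produce an edge `m` smaller
than both smallest bridges, which is a bridge only of the union of the two sets. -/
theorem PotType2.exists_common_bridge (hσ' : PotType2 M ord σ') (hb : IsSBridge ord σ b)
    (hb' : IsSBridge ord σ' b') (hbM : b ∈ M) (heq : σ'.erase b' = σ.erase b)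
    (hlt : ord b < ord b') :
    ∃ m ∈ σ, m ∈ σ' ∧ ord m < ord b ∧ ¬ IsBridge σ m ∧ ¬ IsBridge σ' m ∧
      IsBridge (insert b σ') m := by
  have hbσ := isBridge_iff_forall_exists.1 hb.1
  have hbσ' := isBridge_iff_forall_exists.1 hb'.1
  have hmem : ∀ e, e ≠ b' ∧ e ∈ σ' ↔ e ≠ b ∧ e ∈ σ := by
    simpa [Finset.ext_iff] using heq
  have hne : b ≠ b' := by rintro rfl; exact hlt.false
  have hgap : IsGap M σ' b := isGap_iff_forall_exists.2 ⟨hbM, by grind, by grind⟩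
  have htrue : ¬ IsTrueGap M ord σ' b := fun h ↦ hσ'.not_lt_of_isTrueGap hb' h hlt
  simp only [IsTrueGap, not_and, not_forall] at htrue
  obtain ⟨m, hm, hmb, hmσ'⟩ := htrue hgap
  have hmmem := (isBridge_iff_forall_exists.1 hm).1
  have hmneb : m ≠ b := by rintro rfl; exact hmb.false
  have hmneb' : m ≠ b' := by rintro rfl; exact (hmb.trans hlt).false
  refine ⟨m, by grind, by grind, hmb, fun h ↦ (hb.2 m h).not_gt hmb, hmσ', hm⟩

end Bridges

section Hexagon

variable {V : Type*} [DecidableEq V]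

/-- The edge joining `a i` to its successor in a cyclically indexed family of six vertices. -/
def hexEdge (a : Fin 6 → V) (i : Fin 6) : Finset V := {a i, a (i + 1)}

theorem mem_hexEdge {a : Fin 6 → V} {i : Fin 6} {v : V} :
    v ∈ hexEdge a i ↔ v = a i ∨ v = a (i + 1) := by
  simp [hexEdge]

theorem hexEdge_mem_edgeSets {G : SimpleGraph V} {a : Fin 6 → V}
    (hadj : ∀ i, G.Adj (a i) (a (i + 1))) (i : Fin 6) : hexEdge a i ∈ edgeSets G :=
  ⟨_, _, hadj i, rfl⟩

theorem hexEdge_add_three (a : Fin 6 → V) (i : Fin 6) :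
    hexEdge (fun j ↦ a (j + 3)) i = hexEdge a (i + 3) := by
  simp [hexEdge, add_right_comm]

theorem hexEdge_injective {a : Fin 6 → V} (ha : a.Injective) : (hexEdge a).Injective := by
  intro i j hij
  have h1 : a i ∈ hexEdge a j := hij ▸ mem_hexEdge.2 (.inl rfl)
  have h2 : a (i + 1) ∈ hexEdge a j := hij ▸ mem_hexEdge.2 (.inr rfl)
  simp only [mem_hexEdge, ha.eq_iff] at h1 h2
  omega

/-- The requirements on a total order on the edges of a graph with a hexagon: the edges outside
the hexagon come first, each of them having an endpoint at which it is the largest edge, then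
the two opposite edges with indices `1` and `4`, then the remaining edges of the hexagon. -/
structure IsHexOrder (G : SimpleGraph V) (a : Fin 6 → V) (ord : Finset V → ℕ) : Prop where
  injective : ord.Injective
  exists_largest : ∀ m ∈ edgeSets G, (∀ i, m ≠ hexEdge a i) →
    ∃ y ∈ m, ∀ e ∈ edgeSets G, y ∈ e → e ≠ m → ord e < ord m
  lt_hexEdge : ∀ m ∈ edgeSets G, (∀ i, m ≠ hexEdge a i) → ∀ i, ord m < ord (hexEdge a i)
  hexEdge_lt : ∀ i j : Fin 6, (i = 1 ∨ i = 4) → ¬ (j = 1 ∨ j = 4) →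
    ord (hexEdge a i) < ord (hexEdge a j)

variable {G : SimpleGraph V} {a : Fin 6 → V} {ord : Finset V → ℕ}

theorem IsHexOrder.add_three (h : IsHexOrder G a ord) :
    IsHexOrder G (fun j ↦ a (j + 3)) ord where
  injective := h.injective
  exists_largest m hm hne := h.exists_largest m hm fun i ↦ by
    simpa [hexEdge_add_three] using hne (i - 3)
  lt_hexEdge m hm hne i := by
    rw [hexEdge_add_three]
    exact h.lt_hexEdge m hm (fun i ↦ by simpa [hexEdge_add_three] using hne (i - 3)) _
  hexEdge_lt i j hi hj := by
    simp only [hexEdge_add_three]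
    exact h.hexEdge_lt _ _ (by omega) (by omega)

/-- If the vertices `a 0` and `a 3` have degree two and are covered by edges other than the
neighbours of the edge with index `1`, then the opposite edge, with index `4`, is a bridge or a
true gap, hence dominates the smallest bridge. -/
theorem IsHexOrder.not_potType2_of_hexEdge_one (hord : IsHexOrder G a ord)
    (hadj : ∀ i, G.Adj (a i) (a (i + 1)))
    (h0 : ∀ e ∈ edgeSets G, a 0 ∈ e → e = hexEdge a 0 ∨ e = hexEdge a 5)
    (h3 : ∀ e ∈ edgeSets G, a 3 ∈ e → e = hexEdge a 2 ∨ e = hexEdge a 3)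
    {σ : Finset (Finset V)} (hσM : ↑σ ⊆ edgeSets G) {b : Finset V} (hb : IsSBridge ord σ b)
    (hbhex : b = hexEdge a 0 ∨ b = hexEdge a 2)
    (h0σ : ∃ e ∈ σ, a 0 ∈ e ∧ e ≠ hexEdge a 0)
    (h3σ : ∃ e ∈ σ, a 3 ∈ e ∧ e ≠ hexEdge a 2) : ¬ PotType2 (edgeSets G) ord σ := by
  intro hpot
  have h5 : hexEdge a 5 ∈ σ := by
    obtain ⟨e, he, hae, hne⟩ := h0σ
    rcases h0 e (hσM he) hae with rfl | rfl
    · exact absurd rfl hne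
    · exact he
  have h3' : hexEdge a 3 ∈ σ := by
    obtain ⟨e, he, hae, hne⟩ := h3σ
    rcases h3 e (hσM he) hae with rfl | rfl
    · exact absurd rfl hne
    · exact he
  refine hpot.not_lt_of_covered hb (hexEdge_mem_edgeSets hadj 4) ?_ ?_
  · intro v hv
    rcases mem_hexEdge.1 hv with rfl | rfl
    · exact ⟨_, h3', mem_hexEdge.2 (.inr rfl), hord.hexEdge_lt _ _ (by decide) (by decide)⟩
    · exact ⟨_, h5, mem_hexEdge.2 (.inl rfl), hord.hexEdge_lt _ _ (by decide) (by decide)⟩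
  · rcases hbhex with rfl | rfl <;> exact hord.hexEdge_lt _ _ (by decide) (by decide)

/-- The two smallest bridges of a pair violating the type-2 condition are the neighbours in the
hexagon of one of the edges with indices `1` and `4`. -/
theorem IsHexOrder.exists_middle (hord : IsHexOrder G a ord) (ha : a.Injective)
    {σ σ' : Finset (Finset V)} (hσM : ↑σ ⊆ edgeSets G) (hσM' : ↑σ' ⊆ edgeSets G)
    (hσ' : PotType2 (edgeSets G) ord σ') {b b' : Finset V}
    (hb : IsSBridge ord σ b) (hb' : IsSBridge ord σ' b') (heq : σ'.erase b' = σ.erase b)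
    (hlt : ord b < ord b') :
    ∃ i : Fin 6, (i = 1 ∨ i = 4) ∧
      (b = hexEdge a (i - 1) ∧ b' = hexEdge a (i + 1) ∨
        b = hexEdge a (i + 1) ∧ b' = hexEdge a (i - 1)) := by
  obtain ⟨m, hmσ, hmσ', hmb, hnσ, hnσ', hbr⟩ :=
    hσ'.exists_common_bridge hb hb' (hσM hb.1.1) heq hlt
  have hmem : ∀ e, e ≠ b' ∧ e ∈ σ' ↔ e ≠ b ∧ e ∈ σ := by
    simpa [Finset.ext_iff] using heq
  have hbσ := hb.1.1
  have hbσ' := hb'.1.1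
  have hmneb : m ≠ b := by rintro rfl; exact hmb.false
  have hmneb' : m ≠ b' := by rintro rfl; exact (hmb.trans hlt).false
  rw [isBridge_iff_forall_exists] at hnσ hnσ' hbr
  simp only [hmσ, hmσ', true_and, not_forall, not_exists, not_and] at hnσ hnσ'
  obtain ⟨v, hvm, hv⟩ := hnσ
  obtain ⟨v', hvm', hv'⟩ := hnσ'
  have hvb' : v ∈ b' := by
    obtain ⟨e, he, hem, hve⟩ := hbr.2 v hvm
    grind
  have hvb : v' ∈ b := by
    obtain ⟨e, he, hem, hve⟩ := hbr.2 v' hvm'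
    grind
  have hne : v ≠ v' := by
    rintro rfl
    exact hv b hbσ hmneb.symm hvb
  have hmhex : ∃ i, m = hexEdge a i := by
    by_contra! hm
    obtain ⟨y, hym, hy⟩ := hord.exists_largest m (hσM hmσ) hm
    have hyv : y = v ∨ y = v' := by
      obtain ⟨p, q, -, rfl⟩ := hσM hmσ
      grind
    rcases hyv with rfl | rfl
    · exact ((hy b' (hσM' hbσ') hvb' hmneb'.symm).trans (hmb.trans hlt)).false
    · exact ((hy b (hσM hbσ) hvb hmneb.symm).trans hmb).false
  obtain ⟨i, rfl⟩ := hmhex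
  have hhex : ∀ e ∈ edgeSets G, ord (hexEdge a i) < ord e → ∃ j, e = hexEdge a j := by
    intro e he hlt'
    by_contra! h
    exact (hlt'.trans (hord.lt_hexEdge e he h i)).false
  obtain ⟨j, rfl⟩ := hhex b (hσM hbσ) hmb
  obtain ⟨k, rfl⟩ := hhex b' (hσM' hbσ') (hmb.trans hlt)
  have hij : i ≠ j := fun h ↦ hmneb (by rw [h])
  have hik : i ≠ k := fun h ↦ hmneb' (by rw [h])
  have hjk : j ≠ k := fun h ↦ hlt.ne (by rw [h])
  have hadjacent : ∀ l w, i ≠ l → w ∈ hexEdge a i → w ∈ hexEdge a l → l = i - 1 ∨ l = i + 1 := by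
    intro l w hil hi hl
    rw [mem_hexEdge] at hi hl
    have : i = l ∨ i = l + 1 ∨ i + 1 = l ∨ i + 1 = l + 1 := by
      simp only [← ha.eq_iff]
      grind
    omega
  have hj := hadjacent j v' hij hvm' hvb
  have hk := hadjacent k v hik hvm hvb'
  refine ⟨i, ?_, ?_⟩
  · by_contra hi
    have h : (j = 1 ∨ j = 4) ∨ (k = 1 ∨ k = 4) := by omega
    rcases h with h | h
    · exact ((hord.hexEdge_lt j i h hi).trans hmb).false
    · exact ((hord.hexEdge_lt k i h hi).trans (hmb.trans hlt)).false
  · rcases hj with rfl | rfl <;> rcases hk with rfl | rfl <;> simp_all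

theorem IsHexOrder.bridgeFriendly (hord : IsHexOrder G a ord) (ha : a.Injective)
    (hadj : ∀ i, G.Adj (a i) (a (i + 1)))
    (h0 : ∀ e ∈ edgeSets G, a 0 ∈ e → e = hexEdge a 0 ∨ e = hexEdge a 5)
    (h3 : ∀ e ∈ edgeSets G, a 3 ∈ e → e = hexEdge a 2 ∨ e = hexEdge a 3) :
    BridgeFriendly (edgeSets G) := by
  refine ⟨ord, hord.injective.injOn, fun σ hσM hσ ↦ ⟨hσ, fun σ' hσM' hne hσ' b b' hb hb' heq ↦ ?_⟩⟩
  have hbb' : b ≠ b' := by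
    rintro rfl
    exact hne (by rw [← Finset.insert_erase hb'.1.1, heq, Finset.insert_erase hb.1.1])
  by_contra hlt
  have hlt : ord b' < ord b := lt_of_le_of_ne (not_lt.1 hlt) (hord.injective.ne hbb'.symm)
  have hmem : ∀ e, e ≠ b' ∧ e ∈ σ' ↔ e ≠ b ∧ e ∈ σ := by
    simpa [Finset.ext_iff] using heq
  have hcov : ∀ v ∈ b, ∃ e ∈ σ, v ∈ e ∧ e ≠ b := by
    have := (isBridge_iff_forall_exists.1 hb.1).2
    grind
  have hcov' : ∀ v ∈ b', ∃ e ∈ σ, v ∈ e ∧ e ≠ b' := by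
    have := (isBridge_iff_forall_exists.1 hb'.1).2
    grind
  obtain ⟨i, hi, hmid⟩ := hord.exists_middle ha hσM' hσM hσ hb' hb heq.symm hlt
  rcases hi with rfl | rfl
  · refine hord.not_potType2_of_hexEdge_one hadj h0 h3 hσM hb ?_ ?_ ?_ hσ
    · rcases hmid with ⟨rfl, rfl⟩ | ⟨rfl, rfl⟩ <;> simp
    · rcases hmid with ⟨rfl, rfl⟩ | ⟨rfl, rfl⟩
      · exact hcov' _ (by simp [mem_hexEdge])
      · exact hcov _ (by simp [mem_hexEdge])
    · rcases hmid with ⟨rfl, rfl⟩ | ⟨rfl, rfl⟩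
      · exact hcov _ (by simp [mem_hexEdge])
      · exact hcov' _ (by simp [mem_hexEdge])
  · refine hord.add_three.not_potType2_of_hexEdge_one (fun i ↦ ?_) ?_ ?_ hσM hb ?_ ?_ ?_ hσ
    · simpa [add_right_comm] using hadj (i + 3)
    · intro e he hae
      rw [hexEdge_add_three, hexEdge_add_three]
      exact (h3 e he hae).symm
    · intro e he hae
      rw [hexEdge_add_three, hexEdge_add_three]
      exact (h0 e he hae).symm
    · simp only [hexEdge_add_three]
      rcases hmid with ⟨rfl, rfl⟩ | ⟨rfl, rfl⟩
      · exact .inr rfl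
      · exact .inl rfl
    · simp only [hexEdge_add_three]
      rcases hmid with ⟨rfl, rfl⟩ | ⟨rfl, rfl⟩
      · exact hcov' _ (by simp [mem_hexEdge])
      · exact hcov _ (by simp [mem_hexEdge])
    · simp only [hexEdge_add_three]
      rcases hmid with ⟨rfl, rfl⟩ | ⟨rfl, rfl⟩
      · exact hcov _ (mem_hexEdge.2 (.inr rfl))
      · exact hcov' _ (mem_hexEdge.2 (.inr rfl))

end Hexagon

/-- A cycle of length six, read off from its vertex with a given index. -/
theorem SimpleGraph.Walk.IsCycle.exists_hexagon {V : Type*} {G : SimpleGraph V} {u : V}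
    {w : G.Walk u u} (hw : w.IsCycle) (hlen : w.length = 6) {i : ℕ} (hi : i < 3) :
    ∃ a : Fin 6 → V, a.Injective ∧ (∀ j, G.Adj (a j) (a (j + 1))) ∧
      (∀ e ∈ w.edges, ∃ j, e = s(a j, a (j + 1))) ∧ a 0 = w.getVert i ∧ a 3 = w.getVert (i + 3) := by
  have hlast : w.getVert 6 = w.getVert 0 := by
    rw [← hlen, w.getVert_length, w.getVert_zero]
  have hadj : ∀ k < 6, G.Adj (w.getVert k) (w.getVert ((k + 1) % 6)) := by
    intro k hk
    have := w.adj_getVert_succ (hlen ▸ hk)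
    rcases (show k + 1 < 6 ∨ k = 5 by omega) with h | rfl
    · rwa [Nat.mod_eq_of_lt h]
    · simpa [hlast] using this
  have hsucc : ∀ j : Fin 6, (i + (j + 1 : Fin 6).val) % 6 = ((i + j.val) % 6 + 1) % 6 := by
    intro j
    rw [Fin.val_add]
    simp
    omega
  refine ⟨fun j ↦ w.getVert ((i + j) % 6), fun j k hjk ↦ ?_, fun j ↦ ?_, fun e he ↦ ?_, ?_, ?_⟩
  · have := hw.getVert_injOn' (by simp; omega) (by simp; omega) hjk
    omega
  · simp only [hsucc]
    exact hadj _ (Nat.mod_lt _ (by norm_num))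
  · induction e with | h x y => ?_
    obtain ⟨k, hk, hxy⟩ := w.mk_mem_edges_iff_exists.1 he
    rw [hlen] at hk
    have hj : (i + (k + 6 - i) % 6) % 6 = k := by omega
    refine ⟨⟨(k + 6 - i) % 6, Nat.mod_lt _ (by norm_num)⟩, ?_⟩
    simp only [hsucc, hj]
    rw [← hxy]
    rcases (show k + 1 < 6 ∨ k = 5 by omega) with h | rfl
    · rw [Nat.mod_eq_of_lt h]
    · simp [hlast]
  · simp [Nat.mod_eq_of_lt (show i < 6 by omega)]
  · exact congrArg w.getVert (Nat.mod_eq_of_lt (show i + 3 < 6 by omega))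

section Unicyclic

variable {V : Type*} [DecidableEq V] {G : SimpleGraph V} {a : Fin 6 → V}

/-- If deleting the edge `xy` separates `y` from `r`, then so it does every other neighbour of
`y`, which is therefore farther from `r` than `x` is. -/
theorem SimpleGraph.Connected.dist_lt_of_not_reachable_deleteEdges (hconn : G.Connected)
    {r x y w : V} (hy : ¬ (G.deleteEdges {s(x, y)}).Reachable r y) (hyw : G.Adj y w)
    (hwx : w ≠ x) : G.dist r x < G.dist r w := by
  have hw : ¬ (G.deleteEdges {s(x, y)}).Reachable r w := fun h ↦ hy <| h.trans <|
    SimpleGraph.Adj.reachable <| by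
      rw [SimpleGraph.deleteEdges_adj]
      exact ⟨hyw.symm, by simp [hwx, hyw.ne']⟩
  obtain ⟨p, hp⟩ := hconn.exists_walk_length_eq_dist r w
  have hx : x ∈ p.support :=
    p.fst_mem_support_of_mem_edges (p.mem_edges_of_not_reachable_deleteEdges hw)
  calc G.dist r x ≤ (p.takeUntil x hx).length := SimpleGraph.dist_le _
    _ < p.length := p.length_takeUntil_lt_length hx hwx.symm
    _ = G.dist r w := hp

theorem exists_isHexOrder [Fintype V] (hconn : G.Connected) (ha : a.Injective)
    (hadj : ∀ i, G.Adj (a i) (a (i + 1)))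
    (hcycle : ∀ (u : V) (w : G.Walk u u), w.IsCycle →
      ∀ e ∈ w.edges, ∃ i, e = s(a i, a (i + 1))) :
    ∃ ord, IsHexOrder G a ord := by
  classical
  let d : V → ℕ := G.dist (a 0)
  let B := ∑ v, d v
  let rank : Finset V → ℕ := fun s ↦
    if ∃ i, s = hexEdge a i then
      if s = hexEdge a 1 ∨ s = hexEdge a 4 then B + 1 else B + 2
    else B - ∑ v ∈ s, d v
  let N := Fintype.card (Finset V)
  let enc : Finset V ≃ Fin N := Fintype.equivFin _
  let ord : Finset V → ℕ := fun s ↦ rank s * N + enc s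
  have hlt : ∀ {s t}, rank s < rank t → ord s < ord t := by
    intro s t hst
    calc rank s * N + enc s < rank s * N + N := by gcongr; exact (enc s).2
      _ = (rank s + 1) * N := by ring
      _ ≤ rank t * N := by gcongr; exact hst
      _ ≤ ord t := Nat.le_add_right _ _
  have hB : ∀ s : Finset V, ∑ v ∈ s, d v ≤ B := fun s ↦
    Finset.sum_le_sum_of_subset (Finset.subset_univ s)
  have hinj := hexEdge_injective ha
  refine ⟨ord, ⟨fun s t hst ↦ ?_, ?_, fun m _ hm i ↦ hlt ?_, fun i j hi hj ↦ hlt ?_⟩⟩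
  · rcases lt_trichotomy (rank s) (rank t) with h | h | h
    · exact absurd hst (hlt h).ne
    · have : (enc s : ℕ) = enc t := by simpa [ord, h] using hst
      exact enc.injective (Fin.ext this)
    · exact absurd hst (hlt h).ne'
  · intro m hm hne
    obtain ⟨x, y, hxy, hfar, rfl⟩ : ∃ x y, G.Adj x y ∧
        ¬ (G.deleteEdges {s(x, y)}).Reachable (a 0) y ∧ m = {x, y} := by
      obtain ⟨x, y, hxy, rfl⟩ := hm
      have hbridge : ¬ (G.deleteEdges {s(x, y)}).Reachable x y := by
        intro hr
        obtain ⟨u, p, hp, hmem⟩ :=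
          SimpleGraph.adj_and_reachable_delete_edges_iff_exists_cycle.1 ⟨hxy, hr⟩
        obtain ⟨i, hi⟩ := hcycle u p hp _ hmem
        refine hne i ?_
        rw [← Sym2.toFinset_mk_eq, hi, Sym2.toFinset_mk_eq, hexEdge]
      by_cases hy : (G.deleteEdges {s(x, y)}).Reachable (a 0) y
      · refine ⟨y, x, hxy.symm, fun hx ↦ hbridge ?_, Finset.pair_comm _ _⟩
        rw [Sym2.eq_swap] at hx
        exact hx.symm.trans hy
      · exact ⟨x, y, hxy, hy, rfl⟩
    have hstep : ∀ i, (G.deleteEdges {s(x, y)}).Adj (a i) (a (i + 1)) := by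
      intro i
      rw [SimpleGraph.deleteEdges_adj]
      refine ⟨hadj i, fun h ↦ hne i ?_⟩
      have h : s(a i, a (i + 1)) = s(x, y) := h
      rw [← Sym2.toFinset_mk_eq, ← h, Sym2.toFinset_mk_eq, hexEdge]
    have hreach : ∀ i, (G.deleteEdges {s(x, y)}).Reachable (a 0) (a i) := by
      intro i
      induction i using Fin.induction with
      | zero => rfl
      | succ i ih => exact ih.trans (by simpa using (hstep i.castSucc).reachable)
    refine ⟨y, by simp, fun e he hye hem ↦ hlt ?_⟩
    obtain ⟨w, hyw, rfl⟩ : ∃ w, G.Adj y w ∧ e = {y, w} := by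
      obtain ⟨p, q, hpq, rfl⟩ := he
      rcases Finset.mem_insert.1 hye with rfl | hq
      · exact ⟨q, hpq, rfl⟩
      · rw [Finset.mem_singleton] at hq
        subst hq
        exact ⟨p, hpq.symm, Finset.pair_comm _ _⟩
    have hwx : w ≠ x := by
      rintro rfl
      exact hem (Finset.pair_comm _ _)
    have hlt' : d x < d w := hconn.dist_lt_of_not_reachable_deleteEdges hfar hyw hwx
    have hnehex : ¬ ∃ i, ({y, w} : Finset V) = hexEdge a i := by
      rintro ⟨i, hi⟩
      have : y ∈ hexEdge a i := hi ▸ by simp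
      rcases mem_hexEdge.1 this with rfl | rfl
      · exact hfar (hreach _)
      · exact hfar (hreach _)
    have hB' := hB {y, w}
    simp only [rank, hnehex, not_exists.2 hne, if_false]
    rw [Finset.sum_pair hyw.ne] at hB' ⊢
    rw [Finset.sum_pair hxy.ne]
    omega
  · simp only [rank, not_exists.2 hm, if_false, exists_apply_eq_apply']
    grind
  · have hi' : hexEdge a i = hexEdge a 1 ∨ hexEdge a i = hexEdge a 4 := by
      simpa [hinj.eq_iff] using hi
    have hj' : ¬ (hexEdge a j = hexEdge a 1 ∨ hexEdge a j = hexEdge a 4) := by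
      simpa [hinj.eq_iff] using hj
    simp only [rank, exists_apply_eq_apply', if_true, hi', hj', if_false]
    omega

/-- The edges at a vertex of degree two are those joining it to two given neighbours. -/
theorem eq_or_eq_of_degree_eq_two {v p q : V} [Fintype (G.neighborSet v)] (hdeg : G.degree v = 2)
    (hp : G.Adj v p) (hq : G.Adj v q) (hpq : p ≠ q) {e : Finset V} (he : e ∈ edgeSets G)
    (hv : v ∈ e) : e = {v, p} ∨ e = {v, q} := by
  have hN : {p, q} = G.neighborFinset v := by
    refine Finset.eq_of_subset_of_card_le ?_ ?_
    · simp [Finset.insert_subset_iff, hp, hq]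
    · rw [G.card_neighborFinset_eq_degree, hdeg, Finset.card_pair hpq]
  have hw : ∀ w, G.Adj v w → w = p ∨ w = q := by
    intro w hvw
    rw [← G.mem_neighborFinset, ← hN] at hvw
    simpa using hvw
  obtain ⟨x, y, hxy, rfl⟩ := he
  rcases Finset.mem_insert.1 hv with rfl | hv
  · rcases hw y hxy with rfl | rfl <;> simp
  · rw [Finset.mem_singleton] at hv
    subst hv
    rcases hw x hxy.symm with rfl | rfl <;> simp [Finset.pair_comm]

end Unicyclic

/-- If `G` is a finite connected unicyclic graph whose unique cycle is a `C₆`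
containing two opposite vertices (at distance `3` along the cycle) each of degree `2`
in `G`, then the edge ideal `I(G)` is bridge-friendly. -/
theorem bridgeFriendly_of_C6 {V : Type*} [Fintype V] [DecidableEq V]
    (G : SimpleGraph V) [DecidableRel G.Adj]
    (hconn : G.Connected) (huni : ExactlyOneCycle G)
    (hC6 : ∃ (u : V) (w : G.Walk u u), w.IsCycle ∧ w.length = 6 ∧
      ∃ i < 3, G.degree (w.getVert i) = 2 ∧ G.degree (w.getVert (i + 3)) = 2) :
    BridgeFriendly (edgeSets G) := by
  obtain ⟨u, w, hw, hlen, i, hi, hdeg0, hdeg3⟩ := hC6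
  obtain ⟨a, ha, hadj, hedges, ha0, ha3⟩ := hw.exists_hexagon hlen hi
  rw [← ha0] at hdeg0
  rw [← ha3] at hdeg3
  have hcycle : ∀ (v : V) (w' : G.Walk v v), w'.IsCycle →
      ∀ e ∈ w'.edges, ∃ j, e = s(a j, a (j + 1)) := by
    intro v w' hw' e he
    refine hedges e ?_
    rw [← List.mem_toFinset] at he ⊢
    rwa [huni.2 u v w w' hw hw']
  obtain ⟨ord, hord⟩ := exists_isHexOrder hconn ha hadj hcycle
  refine hord.bridgeFriendly ha hadj (fun e he hae ↦ ?_) (fun e he hae ↦ ?_)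
  · have := eq_or_eq_of_degree_eq_two hdeg0 (hadj 0) (hadj 5).symm (ha.ne (by decide)) he hae
    rwa [Finset.pair_comm (a 0) (a 5)] at this
  · have := eq_or_eq_of_degree_eq_two hdeg3 (hadj 2).symm (hadj 3) (ha.ne (by decide)) he hae
    rwa [Finset.pair_comm (a 3) (a 2)] at this
end

section
/- Let G be the 5-sunlet graph: the simple graph on vertices {1,...,10} whose edges are the 5-cycle {1,2},{2,3},{3,4},{4,5},{5,1} together with the pendant edges {1,6},{2,7},{3,8},{4,9},{5,10}. Then the edge ideal I(G) is not bridge-friendly. -/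
theorem mem_lcmU_s4 {α : Type*} [DecidableEq α] {σ : Finset (Finset α)} {x : α} :
    x ∈ lcmU σ ↔ ∃ m ∈ σ, x ∈ m :=
  Finset.mem_sup

theorem lcmU_insert {α : Type*} [DecidableEq α] (σ : Finset (Finset α)) (m : Finset α) :
    lcmU (insert m σ) = m ∪ lcmU σ :=
  Finset.sup_insert

theorem isBridge_iff {α : Type*} [DecidableEq α] {σ : Finset (Finset α)} {m : Finset α} :
    IsBridge σ m ↔ m ∈ σ ∧ ∀ x ∈ m, ∃ m' ∈ σ, m' ≠ m ∧ x ∈ m' := by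
  refine and_congr_right fun hm => ?_
  have h := lcmU_insert (σ.erase m) m
  rw [Finset.insert_erase hm] at h
  rw [h, eq_comm, Finset.union_eq_right]
  simp only [Finset.subset_iff, mem_lcmU_s4, Finset.mem_erase]
  grind

theorem IsGap.exists_mem {α : Type*} [DecidableEq α] {M : Set (Finset α)}
    {σ : Finset (Finset α)} {m : Finset α} (h : IsGap M σ m) : ∀ x ∈ m, ∃ m' ∈ σ, x ∈ m' :=
  fun _ hx => mem_lcmU_s4.1 (h.2.2 ▸ mem_lcmU_s4.2 ⟨m, Finset.mem_insert_self m σ, hx⟩)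

/-- Two type-2 sets that agree after removing their smallest bridges are equal. -/
theorem Type2.eq_of_erase_eq {α : Type*} [DecidableEq α] {M : Set (Finset α)}
    {ord : Finset α → ℕ} {σ σ' : Finset (Finset α)} {b b' : Finset α}
    (h : Type2 M ord σ) (h' : Type2 M ord σ') (hσ : ↑σ ⊆ M) (hσ' : ↑σ' ⊆ M)
    (hb : IsSBridge ord σ b) (hb' : IsSBridge ord σ' b') (he : σ.erase b = σ'.erase b') :
    σ = σ' := by
  by_contra hne
  exact lt_asymm (h.2 σ' hσ' (Ne.symm hne) h'.1 b b' hb hb' he.symm)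
    (h'.2 σ hσ hne h.1 b' b hb' hb he)

/-- If `f` is the only bridge of `σ`, and `g` the only gap, then `σ` is potentially-type-2 as soon
as adding `g` creates a new bridge `e` dominated by `g`. -/
theorem PotType2.of_unique_bridge_gap {α : Type*} [DecidableEq α] {M : Set (Finset α)}
    {ord : Finset α → ℕ} {σ : Finset (Finset α)} {e f g : Finset α}
    (hf : IsBridge σ f) (hgap : ∀ m, IsGap M σ m → m = g)
    (he : IsBridge (insert g σ) e) (hne : ¬ IsBridge σ e) (hlt : ord e < ord g) :
    PotType2 M ord σ := by
  refine ⟨f, hf, fun m hm _ => ?_⟩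
  obtain rfl := hgap m hm.1
  exact hne (hm.2 e he hlt)

theorem IsSBridge.of_unique {α : Type*} [DecidableEq α] {ord : Finset α → ℕ}
    {σ : Finset (Finset α)} {f : Finset α} (h : ∀ m, IsBridge σ m ↔ m = f) :
    IsSBridge ord σ f :=
  ⟨(h f).2 rfl, fun m hm => by rw [(h m).1 hm]⟩

/-- The edge of the 5-cycle joining `i` to `i + 1`. -/
def cycleEdge (i : Fin 5) : Finset (Fin 10) := {i.castAdd 5, (i + 1).castAdd 5}

/-- The pendant edge at the cycle vertex `i`. -/
def pendantEdge (i : Fin 5) : Finset (Fin 10) := {i.castAdd 5, i.natAdd 5}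

/-- The edges of the 5-sunlet graph. -/
def sunletEdges : Finset (Finset (Fin 10)) :=
  {{0, 1}, {1, 2}, {2, 3}, {3, 4}, {4, 0}, {0, 5}, {1, 6}, {2, 7}, {3, 8}, {4, 9}}

/-- The cycle edge at `i` with the pendant edges at the far ends of its two neighbours. -/
def sunletCore (i : Fin 5) : Finset (Finset (Fin 10)) :=
  {cycleEdge i, pendantEdge (i + 2), pendantEdge (i + 4)}

theorem insert_sunletCore_subset (i j : Fin 5) :
    insert (cycleEdge j) (sunletCore i) ⊆ sunletEdges := by
  decide +kernel +revert

theorem cycleEdge_notMem_sunletCore {i j : Fin 5} (h : j = i + 1 ∨ j = i + 4) :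
    cycleEdge j ∉ sunletCore i := by
  decide +kernel +revert

set_option synthInstance.maxSize 1000 in
theorem isBridge_insert_sunletCore {i j : Fin 5} (h : j = i + 1 ∨ j = i + 4)
    (m : Finset (Fin 10)) :
    IsBridge (insert (cycleEdge j) (sunletCore i)) m ↔ m = cycleEdge j := by
  have key : ∀ i j : Fin 5, j = i + 1 ∨ j = i + 4 →
      IsBridge (insert (cycleEdge j) (sunletCore i)) (cycleEdge j) ∧
        ∀ m ∈ insert (cycleEdge j) (sunletCore i),
          IsBridge (insert (cycleEdge j) (sunletCore i)) m → m = cycleEdge j := by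
    simp only [isBridge_iff, sunletCore, Finset.mem_insert, Finset.mem_singleton,
      forall_eq_or_imp, forall_eq, exists_eq_or_imp, exists_eq_left]
    decide +kernel
  exact ⟨fun hm => (key i j h).2 m hm.1 hm, fun hm => hm ▸ (key i j h).1⟩

set_option synthInstance.maxSize 4000 in
set_option synthInstance.maxHeartbeats 400000 in
theorem eq_of_isGap_insert_sunletCore {i j k : Fin 5}
    (h : (j = i + 1 ∧ k = i + 4) ∨ (j = i + 4 ∧ k = i + 1)) {m : Finset (Fin 10)}
    (hm : IsGap ↑sunletEdges (insert (cycleEdge j) (sunletCore i)) m) : m = cycleEdge k := by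
  have key : ∀ i j k : Fin 5, (j = i + 1 ∧ k = i + 4) ∨ (j = i + 4 ∧ k = i + 1) →
      ∀ m ∈ sunletEdges, m ∉ insert (cycleEdge j) (sunletCore i) →
        (∀ x ∈ m, ∃ m' ∈ insert (cycleEdge j) (sunletCore i), x ∈ m') → m = cycleEdge k := by
    simp only [sunletCore, sunletEdges, Finset.mem_insert, Finset.mem_singleton,
      forall_eq_or_imp, forall_eq, exists_eq_or_imp, exists_eq_left]
    decide +kernel
  exact key i j k h m (Finset.mem_coe.1 hm.1) hm.2.1 hm.exists_mem

set_option synthInstance.maxSize 1000 in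
theorem isBridge_insert_insert_sunletCore {i j k : Fin 5}
    (h : (j = i + 1 ∧ k = i + 4) ∨ (j = i + 4 ∧ k = i + 1)) :
    IsBridge (insert (cycleEdge k) (insert (cycleEdge j) (sunletCore i))) (cycleEdge i) := by
  simp only [isBridge_iff, sunletCore, Finset.mem_insert, Finset.mem_singleton,
    exists_eq_or_imp, exists_eq_left]
  decide +kernel +revert

theorem cycleEdge_injective : Function.Injective cycleEdge := by
  intro i j
  decide +kernel +revert

theorem cycleEdge_mem_sunletEdges (i : Fin 5) : cycleEdge i ∈ sunletEdges := by
  decide +kernel +revert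

theorem potType2_insert_sunletCore {ord : Finset (Fin 10) → ℕ} {i j k : Fin 5}
    (h : (j = i + 1 ∧ k = i + 4) ∨ (j = i + 4 ∧ k = i + 1))
    (hlt : ord (cycleEdge i) < ord (cycleEdge k)) :
    PotType2 ↑sunletEdges ord (insert (cycleEdge j) (sunletCore i)) := by
  have hj : j = i + 1 ∨ j = i + 4 := h.imp And.left And.left
  refine .of_unique_bridge_gap ((isBridge_insert_sunletCore hj _).2 rfl)
    (fun m => eq_of_isGap_insert_sunletCore h) (isBridge_insert_insert_sunletCore h) ?_ hlt
  rw [isBridge_insert_sunletCore hj]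
  intro he
  exact cycleEdge_notMem_sunletCore hj (he ▸ by simp [sunletCore])

/-- The edge ideal of the 5-sunlet graph (a 5-cycle `0-1-2-3-4` with pendant vertices
`5,…,9` attached to `0,…,4` respectively) is not bridge-friendly.  (Vertices `1,…,10`
of the statement are relabelled `0,…,9`.) -/
theorem sunlet5_not_bridgeFriendly :
    ¬ BridgeFriendly ({{0, 1}, {1, 2}, {2, 3}, {3, 4}, {4, 0},
        {0, 5}, {1, 6}, {2, 7}, {3, 8}, {4, 9}} : Set (Finset (Fin 10))) := by
  rintro ⟨ord, hinj, hord⟩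
  have hM : ({{0, 1}, {1, 2}, {2, 3}, {3, 4}, {4, 0},
      {0, 5}, {1, 6}, {2, 7}, {3, 8}, {4, 9}} : Set (Finset (Fin 10))) = ↑sunletEdges := by
    simp [sunletEdges]
  rw [hM] at hinj hord
  obtain ⟨i, hi⟩ := Finite.exists_min fun i => ord (cycleEdge i)
  have hlt (k : Fin 5) (hk : k ≠ i) : ord (cycleEdge i) < ord (cycleEdge k) :=
    lt_of_le_of_ne (hi k) fun h => hk <| cycleEdge_injective <|
      (hinj (cycleEdge_mem_sunletEdges i) (cycleEdge_mem_sunletEdges k) h).symm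
  have hsub (j : Fin 5) : (↑(insert (cycleEdge j) (sunletCore i)) : Set (Finset (Fin 10))) ⊆
      ↑sunletEdges := Finset.coe_subset.2 (insert_sunletCore_subset i j)
  have h₁ := hord _ (hsub (i + 1))
    (potType2_insert_sunletCore (.inl ⟨rfl, rfl⟩) (hlt (i + 4) (by simp)))
  have h₄ := hord _ (hsub (i + 4))
    (potType2_insert_sunletCore (.inr ⟨rfl, rfl⟩) (hlt (i + 1) (by simp)))
  have n₁ := cycleEdge_notMem_sunletCore (i := i) (.inl rfl)
  have n₄ := cycleEdge_notMem_sunletCore (i := i) (.inr rfl)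
  have heq := h₁.eq_of_erase_eq h₄ (hsub _) (hsub _)
    (.of_unique (isBridge_insert_sunletCore (.inl rfl)))
    (.of_unique (isBridge_insert_sunletCore (.inr rfl)))
    (by rw [Finset.erase_insert n₁, Finset.erase_insert n₄])
  have hc : cycleEdge (i + 1) = cycleEdge (i + 4) := (Finset.insert_inj n₁).1 heq
  exact absurd (add_left_cancel (cycleEdge_injective hc)) (by decide)
end
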